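/- There exists a C¹ flow h_t on the two-torus 𝕋² without critical points and without periodic orbits, admitting a closed transversal whose first return map has a rotation number of constant type, which is not minimal: there exists a nonempty closed h_t-invariant subset K ⊊ 𝕋² with K ≠ 𝕋². Moreover the flow can be chosen so that there exist a C¹ diffeomorphism F of 𝕋² and a constant c ∈ (0,1) with F ∘ h_t = h_{ct} ∘ F for all t ∈ ℝ. -/

import Mathlib

open MeasureTheory Set
noncomputable section

/-- The two-torus `𝕋² = ℝ²/ℤ²`. -/
abbrev T2 : Type := AddCircle (1:ℝ) × AddCircle (1:ℝ)

/-- Projection `ℝ² → 𝕋²`. -/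
def projT2 (v : ℝ × ℝ) : T2 := (↑v.1, ↑v.2)

/-- A `C¹` flow on the two-torus, encoded by a jointly `C¹` lift to ℝ². -/
structure C1FlowT2 where
  flow : ℝ → T2 → T2
  lift : ℝ → ℝ × ℝ → ℝ × ℝ
  lift_contDiff : ContDiff ℝ 1 (Function.uncurry lift)
  lift_proj : ∀ t v, projT2 (lift t v) = flow t (projT2 v)
  flow_zero : ∀ x, flow 0 x = x
  flow_add : ∀ t s x, flow (t + s) x = flow t (flow s x)

namespace C1FlowT2
/-- The generating vector field of the flow (read in the universal cover). -/
def vf (h : C1FlowT2) (v : ℝ × ℝ) : ℝ × ℝ := deriv (fun t => h.lift t v) 0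
/-- The flow has no critical points: its generating vector field never vanishes. -/
def NoCriticalPoints (h : C1FlowT2) : Prop := ∀ v, h.vf v ≠ 0
/-- The flow has no periodic orbits. -/
def NoPeriodicOrbits (h : C1FlowT2) : Prop := ∀ x T, 0 < T → h.flow T x ≠ x
end C1FlowT2

/-- A closed transversal curve of the flow: a `C¹` embedded circle, everywhere
transverse to the generating vector field, meeting every orbit. -/
structure ClosedTransversal (h : C1FlowT2) where
  γ : AddCircle (1:ℝ) → T2
  lift : ℝ → ℝ × ℝ
  lift_contDiff : ContDiff ℝ 1 lift
  lift_proj : ∀ s : ℝ, projT2 (lift s) = γ ↑s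
  inj : Function.Injective γ
  transverse : ∀ s : ℝ,
    (deriv lift s).1 * (h.vf (lift s)).2 - (deriv lift s).2 * (h.vf (lift s)).1 ≠ 0
  meets : ∀ x : T2, ∃ t : ℝ, h.flow t x ∈ Set.range γ

/-- First return time to the transversal: `u x = inf {t > 0 | h_t x ∈ γ(𝕊¹)}`. -/
def returnTime (h : C1FlowT2) (Γ : ClosedTransversal h) (x : T2) : ℝ :=
  sInf {t : ℝ | 0 < t ∧ h.flow t x ∈ Set.range Γ.γ}

/-- `F : CircleDeg1Lift` is a lift of the first return map of the flow to the
transversal `Γ`, read in the parametrization of `Γ` by the circle. -/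
def ReturnMapLift (h : C1FlowT2) (Γ : ClosedTransversal h) (F : CircleDeg1Lift) : Prop :=
  ∀ s : ℝ, Γ.γ ↑(F s) = h.flow (returnTime h Γ (Γ.γ ↑s)) (Γ.γ ↑s)

/-- A real number is of constant type if it is irrational and the partial quotients
of its continued fraction expansion are bounded. -/
def IsOfConstantType (ω : ℝ) : Prop :=
  Irrational ω ∧ ∃ B : ℝ, ∀ n : ℕ, ∀ a ∈ (GenContFract.of ω).partDens.get? n, a ≤ B

/-- `C¹` norm of an observable on the torus. -/
def C1Norm (f : T2 → ℝ) : ℝ :=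
  (⨆ v : ℝ × ℝ, |f (projT2 v)|) + ⨆ v : ℝ × ℝ, ‖fderiv ℝ (fun w => f (projT2 w)) v‖

/-- Ergodic integral `H_{x,T}(f) = ∫₀^T f(h_t x) dt`. -/
def ergInt (h : C1FlowT2) (f : T2 → ℝ) (x : T2) (T : ℝ) : ℝ :=
  ∫ t in (0:ℝ)..T, f (h.flow t x)

section Construction

open Filter Topology

/-- The inverse of the golden ratio. -/
def gInv : ℝ := (√5 - 1) / 2

lemma gInv_sq : gInv ^ 2 = 1 - gInv := by
  have := Real.sq_sqrt (show (0:ℝ) ≤ 5 by norm_num)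
  unfold gInv; nlinarith

lemma gInv_pos : 0 < gInv := by
  have : (1:ℝ) < √5 := Real.lt_sqrt_of_sq_lt (by norm_num)
  unfold gInv; linarith

lemma gInv_gt : (618 / 1000 : ℝ) < gInv := by nlinarith [gInv_sq, gInv_pos]

lemma gInv_lt : gInv < 6181 / 10000 := by nlinarith [gInv_sq, gInv_pos]

lemma gInv_inv : gInv⁻¹ = 1 + gInv := by
  rw [inv_eq_one_div, div_eq_iff gInv_pos.ne']
  linarith [gInv_sq]

lemma gInv_irrational : Irrational gInv := by
  have h : Irrational (√(5:ℕ)) := Nat.Prime.irrational_sqrt (by norm_num)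
  have := (h.sub_natCast 1).div_natCast (m := 2) (by norm_num)
  simpa [gInv] using this

lemma fract_gInv : Int.fract gInv = gInv :=
  Int.fract_eq_self.2 ⟨gInv_pos.le, by linarith [gInv_lt]⟩

lemma stream_gInv (n : ℕ) :
    GenContFract.IntFractPair.stream gInv n =
      some ⟨if n = 0 then 0 else 1, gInv⟩ := by
  induction n with
  | zero =>
    have : ⌊gInv⌋ = 0 := Int.floor_eq_zero_iff.2 ⟨gInv_pos.le, by linarith [gInv_lt]⟩
    simp [GenContFract.IntFractPair.stream, GenContFract.IntFractPair.of, fract_gInv, this]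
  | succ n ih =>
    have h1 : ⌊1 + gInv⌋ = 1 := by
      rw [Int.floor_eq_iff]; push_cast
      constructor <;> linarith [gInv_lt, gInv_pos]
    have h2 : Int.fract (1 + gInv) = gInv := by
      rw [← Int.self_sub_floor, h1]; push_cast; ring
    simp [GenContFract.IntFractPair.stream, ih, gInv_pos.ne', gInv_inv,
      GenContFract.IntFractPair.of, h1, h2]

/-- The perturbed contraction `x ↦ x / φ + sin (2 π x) (1 - 1 / φ) / 4`. -/
def gMap (x : ℝ) : ℝ := gInv * x + (1 - gInv) / 4 * Real.sin (2 * Real.pi * x)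

/-- The derivative of `gMap`. -/
def gDer (x : ℝ) : ℝ := gInv + Real.pi / 2 * (1 - gInv) * Real.cos (2 * Real.pi * x)

lemma hasDerivAt_gMap (x : ℝ) : HasDerivAt gMap (gDer x) x := by
  have h1 : HasDerivAt (fun x : ℝ => 2 * Real.pi * x) (2 * Real.pi) x := by
    simpa using (hasDerivAt_id x).const_mul (2 * Real.pi)
  have h2 := ((hasDerivAt_id x).const_mul gInv).add (h1.sin.const_mul ((1 - gInv) / 4))
  refine h2.congr_deriv ?_
  simp only [gDer]; ring

lemma gDer_lower (x : ℝ) : 1 / 100 ≤ gDer x := by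
  have h := Real.neg_one_le_cos (2 * Real.pi * x)
  have := Real.pi_lt_d2
  have := Real.pi_gt_three
  have := gInv_gt
  have := gInv_lt
  have h3 : 0 ≤ Real.pi / 2 * (1 - gInv) := by apply mul_nonneg <;> linarith
  have h4 : Real.pi / 2 * (1 - gInv) ≤ 3.15 / 2 * (382 / 1000) := by gcongr <;> linarith
  unfold gDer
  nlinarith

lemma gDer_pos (x : ℝ) : 0 < gDer x := lt_of_lt_of_le (by norm_num) (gDer_lower x)

lemma gDer_upper (x : ℝ) : gDer x ≤ 5 / 4 := by
  have h := Real.cos_le_one (2 * Real.pi * x)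
  have := Real.pi_lt_d2
  have := Real.pi_gt_three
  have := gInv_gt
  have := gInv_lt
  have h3 : 0 ≤ Real.pi / 2 * (1 - gInv) := by apply mul_nonneg <;> linarith
  have h4 : Real.pi / 2 * (1 - gInv) ≤ 3.15 / 2 * (382 / 1000) := by gcongr <;> linarith
  unfold gDer
  nlinarith

lemma gDer_zero : 1 < gDer 0 := by
  have := Real.pi_gt_three
  have := gInv_lt
  simp only [gDer, mul_zero, Real.cos_zero, mul_one]
  nlinarith

lemma continuous_gDer : Continuous gDer := by unfold gDer; fun_prop

lemma abs_gDer_sub_le (x y : ℝ) : |gDer x - gDer y| ≤ 4 * |x - y| := by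
  have h : gDer x - gDer y = Real.pi / 2 * (1 - gInv) *
      (Real.cos (2 * Real.pi * x) - Real.cos (2 * Real.pi * y)) := by unfold gDer; ring
  have := Real.pi_lt_d2
  have := Real.pi_gt_three
  have := gInv_gt
  have := gInv_lt
  have h3 : 0 ≤ Real.pi / 2 * (1 - gInv) := by apply mul_nonneg <;> linarith
  have h4 : Real.pi / 2 * (1 - gInv) ≤ 3.15 / 2 * (382 / 1000) := by gcongr <;> linarith
  have h5 : |Real.cos (2 * Real.pi * x) - Real.cos (2 * Real.pi * y)|
      ≤ 6.3 * |x - y| := by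
    have h6 := Real.abs_cos_sub_cos_le (2 * Real.pi * x) (2 * Real.pi * y)
    rw [← mul_sub, abs_mul, abs_of_pos (by positivity : 0 < 2 * Real.pi)] at h6
    refine h6.trans ?_
    gcongr; linarith
  rw [h, abs_mul, abs_of_nonneg h3]
  calc _ ≤ (3.15 / 2 * (382 / 1000)) * (6.3 * |x - y|) := by gcongr
    _ ≤ _ := by nlinarith [abs_nonneg (x - y)]

lemma abs_log_gDer_sub_le (x y : ℝ) :
    |Real.log (gDer x) - Real.log (gDer y)| ≤ 400 * |x - y| := by
  have key : ∀ x y, Real.log (gDer x) - Real.log (gDer y) ≤ 400 * |x - y| := by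
    intro x y
    have hx := gDer_pos x
    have hy := gDer_pos y
    rw [← Real.log_div hx.ne' hy.ne']
    have h1 := Real.log_le_sub_one_of_pos (div_pos hx hy)
    have h2 : gDer x / gDer y - 1 = (gDer x - gDer y) / gDer y := by field_simp
    rw [h2] at h1
    refine h1.trans ?_
    rw [div_le_iff₀ hy]
    have h3 := abs_gDer_sub_le x y
    have h4 := gDer_lower y
    nlinarith [le_abs_self (gDer x - gDer y), abs_nonneg (x - y)]
  rw [abs_sub_le_iff]
  exact ⟨key x y, by rw [abs_sub_comm]; exact key y x⟩

lemma continuous_gMap : Continuous gMap := by unfold gMap; fun_prop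

lemma contDiff_gMap : ContDiff ℝ 1 gMap := by unfold gMap; fun_prop

lemma strictMono_gMap : StrictMono gMap :=
  strictMono_of_hasDerivAt_pos hasDerivAt_gMap gDer_pos

lemma abs_gMap_sub_le (x : ℝ) : |gMap x - gInv * x| ≤ 1 / 4 := by
  have h := Real.abs_sin_le_one (2 * Real.pi * x)
  have := gInv_pos
  have := gInv_lt
  rw [gMap, add_sub_cancel_left, abs_mul, abs_of_nonneg (by linarith)]
  nlinarith [abs_nonneg (Real.sin (2 * Real.pi * x))]

lemma abs_gMap_dist_le (x y : ℝ) : |gMap x - gMap y| ≤ 5 / 4 * |x - y| := by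
  have := Convex.norm_image_sub_le_of_norm_hasDerivWithin_le (f := gMap) (f' := gDer)
    (s := Set.univ) (C := 5 / 4) (x := y) (y := x)
    (fun z _ => (hasDerivAt_gMap z).hasDerivWithinAt)
    (fun z _ => by
      rw [Real.norm_eq_abs, abs_of_pos (gDer_pos z)]; exact gDer_upper z)
    convex_univ (Set.mem_univ _) (Set.mem_univ _)
  simpa using this

lemma gMap_add_int (x : ℝ) (n : ℤ) : gMap (x + n) = gMap x + gInv * n := by
  have : 2 * Real.pi * (x + n) = 2 * Real.pi * x + n * (2 * Real.pi) := by ring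
  rw [gMap, this, Real.sin_add_int_mul_two_pi, gMap]; ring

lemma gMap_zero : gMap 0 = 0 := by simp [gMap]

lemma gMap_quarter : gMap (1 / 4) = 1 / 4 := by
  rw [gMap, show 2 * Real.pi * (1 / 4) = Real.pi / 2 by ring, Real.sin_pi_div_two]; ring

lemma gMap_neg (x : ℝ) : gMap (-x) = - gMap x := by
  simp only [gMap, mul_neg, Real.sin_neg]; ring

lemma surjective_gMap : Function.Surjective gMap := by
  have h := gInv_pos
  apply continuous_gMap.surjective
  · refine tendsto_atTop_mono (f := fun x => gInv * x - 1 / 4) (fun x => ?_) ?_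
    · linarith [(abs_le.1 (abs_gMap_sub_le x)).1]
    · exact tendsto_atTop_add_const_right _ _ (tendsto_id.const_mul_atTop h)
  · refine tendsto_atBot_mono (g := gMap) (f := fun x => gInv * x + 1 / 4) (fun x => ?_) ?_
    · linarith [(abs_le.1 (abs_gMap_sub_le x)).2]
    · exact tendsto_atBot_add_const_right _ _ (tendsto_id.const_mul_atBot h)

/-- `gMap` as an order isomorphism. -/
def gIso : ℝ ≃o ℝ := strictMono_gMap.orderIsoOfSurjective gMap surjective_gMap

/-- The inverse of `gMap`. -/
def gSymm (y : ℝ) : ℝ := gIso.symm y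

@[simp] lemma gMap_gSymm (y : ℝ) : gMap (gSymm y) = y := gIso.apply_symm_apply y

@[simp] lemma gSymm_gMap (x : ℝ) : gSymm (gMap x) = x := gIso.symm_apply_apply x

lemma continuous_gSymm : Continuous gSymm := gIso.symm.continuous

lemma hasDerivAt_gSymm (y : ℝ) : HasDerivAt gSymm (gDer (gSymm y))⁻¹ y :=
  HasDerivAt.of_local_left_inverse continuous_gSymm.continuousAt (hasDerivAt_gMap _)
    (gDer_pos _).ne' (Eventually.of_forall gMap_gSymm)

lemma contDiff_gSymm : ContDiff ℝ 1 gSymm := by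
  rw [contDiff_one_iff_deriv]
  refine ⟨fun y => (hasDerivAt_gSymm y).differentiableAt, ?_⟩
  rw [funext fun y => (hasDerivAt_gSymm y).deriv]
  exact (continuous_gDer.comp continuous_gSymm).inv₀ fun y => (gDer_pos _).ne'

lemma gSymm_add_int (y : ℝ) (n : ℤ) : gSymm (y + gInv * n) = gSymm y + n :=
  strictMono_gMap.injective (by rw [gMap_add_int]; simp)

lemma gSymm_zero : gSymm 0 = 0 := by rw [← gMap_zero, gSymm_gMap, gMap_zero]

lemma exists_gSymm_contracts :
    ∃ δ > 0, ∃ κ : ℝ, 0 ≤ κ ∧ κ < 1 ∧ ∀ y, |y| ≤ δ → |gSymm y| ≤ κ * |y| := by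
  have h := hasDerivAt_gSymm 0
  rw [gSymm_zero] at h
  have hlt : (gDer 0)⁻¹ < 1 := inv_lt_one_of_one_lt₀ gDer_zero
  have hp : 0 < (gDer 0)⁻¹ := inv_pos.2 (gDer_pos 0)
  obtain ⟨κ, h1, h2⟩ := exists_between hlt
  have h3 := (hasDerivAt_iff_isLittleO.1 h).def (sub_pos.2 h1)
  obtain ⟨δ, hδ, h4⟩ := Metric.eventually_nhds_iff.1 h3
  refine ⟨δ / 2, by positivity, κ, by linarith, h2, fun y hy => ?_⟩
  have h5 := h4 (y := y) (by simp only [dist_zero_right, Real.norm_eq_abs]; linarith)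
  simp only [gSymm_zero, sub_zero, smul_eq_mul, Real.norm_eq_abs] at h5
  have h6 : |gSymm y| ≤ |gSymm y - y * (gDer 0)⁻¹| + |y * (gDer 0)⁻¹| := by
    simpa using abs_add_le (gSymm y - y * (gDer 0)⁻¹) (y * (gDer 0)⁻¹)
  rw [abs_mul y, abs_of_pos hp] at h6
  linarith

lemma isOfConstantType_gInv_aux (n : ℕ) :
    ∀ a ∈ (GenContFract.of gInv).partDens.get? n, a ≤ 1 := by
  intro a ha
  obtain ⟨p, hp, rfl⟩ := GenContFract.exists_s_b_of_partDen ha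
  obtain ⟨q, hq, h⟩ :=
    GenContFract.IntFractPair.exists_succ_get?_stream_of_gcf_of_get?_eq_some hp
  rw [stream_gInv] at hq
  simp only [Nat.add_eq_zero_iff, one_ne_zero, and_false, if_false, Option.some.injEq] at hq
  rw [← h, ← hq]; simp

/-- The slope of the linear leaves, `1 / √5`. -/
def leafSlope : ℝ := (1 + 2 * gInv) / 5

/-- The action of the inverse renormalization on a point `(x, a)` together with a second height `b`:
`(x, a)` is sent to its preimage and both heights are multiplied by `gInv`. -/
def renorm (P : ℝ × ℝ × ℝ) : ℝ × ℝ × ℝ :=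
  (gSymm (gInv * P.2.1 - P.1), gInv * P.2.1, gInv * P.2.2)

/-- Approximations to the holonomy: `leafSeq n (x, a, b)` is the first coordinate at height `b` of
the `n`-th approximate leaf passing through `(x, a)`. -/
def leafSeq : ℕ → ℝ × ℝ × ℝ → ℝ
  | 0, P => P.1 + leafSlope * (P.2.2 - P.2.1)
  | n + 1, P => gInv * P.2.2 - gMap (leafSeq n (renorm P))

/-- The derivative of `leafSeq` in the final height. -/
def slopeSeq : ℕ → ℝ × ℝ × ℝ → ℝ
  | 0, _ => leafSlope
  | n + 1, P => gInv - gInv * gDer (leafSeq n (renorm P)) * slopeSeq n (renorm P)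

/-- The logarithm of the derivative of `leafSeq` in the first coordinate. -/
def logSeq : ℕ → ℝ × ℝ × ℝ → ℝ
  | 0, _ => 0
  | n + 1, P => Real.log (gDer (leafSeq n (renorm P))) - Real.log (gDer (renorm P).1) +
      logSeq n (renorm P)

lemma renorm_height_sub (P : ℝ × ℝ × ℝ) :
    |(renorm P).2.2 - (renorm P).2.1| = gInv * |P.2.2 - P.2.1| := by
  simp only [renorm]
  rw [← mul_sub, abs_mul, abs_of_pos gInv_pos]

lemma gMap_renorm (P : ℝ × ℝ × ℝ) : gMap (renorm P).1 = gInv * P.2.1 - P.1 := gMap_gSymm _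

lemma leafSeq_self (n : ℕ) (x a : ℝ) : leafSeq n (x, a, a) = x := by
  induction n generalizing x a with
  | zero => simp [leafSeq]
  | succ n ih => simp [leafSeq, renorm, ih]

lemma abs_leafSeq_succ_sub (n : ℕ) (P : ℝ × ℝ × ℝ) :
    |leafSeq (n + 1) P - leafSeq n P| ≤ |P.2.2 - P.2.1| * (9 / 10) ^ n := by
  have h0 := gInv_pos
  have h1 := gInv_gt
  have h2 := gInv_lt
  induction n generalizing P with
  | zero =>
    have h3 := abs_gMap_dist_le ((renorm P).1 +
      leafSlope * ((renorm P).2.2 - (renorm P).2.1)) (renorm P).1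
    have hl : leafSlope * (5 / 4 * gInv) ≤ 1 / 2 := by unfold leafSlope; nlinarith [gInv_sq]
    have hl0 : 0 < leafSlope := by unfold leafSlope; linarith
    have hl1 : 0 ≤ gInv - leafSlope := by unfold leafSlope; linarith
    have hl2 : gInv - leafSlope ≤ 1 / 2 := by unfold leafSlope; linarith
    rw [add_sub_cancel_left, abs_mul, renorm_height_sub, abs_of_pos hl0] at h3
    have h4 : leafSeq (0 + 1) P - leafSeq 0 P = (gInv - leafSlope) * (P.2.2 - P.2.1) -
        (gMap ((renorm P).1 + leafSlope * ((renorm P).2.2 - (renorm P).2.1)) -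
          gMap (renorm P).1) := by
      rw [gMap_renorm]; simp only [leafSeq]; ring
    rw [h4]
    refine (abs_sub _ _).trans ?_
    rw [abs_mul, abs_of_nonneg hl1]
    nlinarith [abs_nonneg (P.2.2 - P.2.1)]
  | succ n ih =>
    have h3 := ih (renorm P)
    rw [renorm_height_sub] at h3
    have h4 := abs_gMap_dist_le (leafSeq (n + 1) (renorm P)) (leafSeq n (renorm P))
    have h5 : leafSeq (n + 1 + 1) P - leafSeq (n + 1) P =
      -(gMap (leafSeq (n + 1) (renorm P)) - gMap (leafSeq n (renorm P))) := by
      rw [leafSeq, leafSeq.eq_def (n + 1) P]; ring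
    rw [h5, abs_neg, pow_succ]
    have h6 : 0 ≤ |P.2.2 - P.2.1| * (9 / 10) ^ n := by positivity
    nlinarith

lemma slopeSeq_mem (n : ℕ) (P : ℝ × ℝ × ℝ) : 1 / 10 ≤ slopeSeq n P ∧ slopeSeq n P ≤ gInv := by
  have h0 := gInv_pos
  have h1 := gInv_gt
  have h2 := gInv_lt
  induction n generalizing P with
  | zero => simp only [slopeSeq, leafSlope]; constructor <;> linarith
  | succ n ih =>
    obtain ⟨h3, h4⟩ := ih (renorm P)
    have h5 := gDer_pos (leafSeq n (renorm P))
    have h6 := gDer_upper (leafSeq n (renorm P))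
    rw [slopeSeq, mul_assoc]
    have h7 : 0 ≤ gDer (leafSeq n (renorm P)) * slopeSeq n (renorm P) := by positivity
    have h8 : gDer (leafSeq n (renorm P)) * slopeSeq n (renorm P) ≤ 5 / 4 * gInv := by
      gcongr
    constructor <;> nlinarith

lemma abs_slopeSeq_le (n : ℕ) (P : ℝ × ℝ × ℝ) : |slopeSeq n P| ≤ 1 := by
  have := slopeSeq_mem n P
  have h2 := gInv_lt
  rw [abs_le]; constructor <;> linarith

lemma abs_slopeSeq_succ_sub (n : ℕ) (P : ℝ × ℝ × ℝ) :
    |slopeSeq (n + 1) P - slopeSeq n P| ≤ 13 * (1 + |P.2.2 - P.2.1|) * (9 / 10) ^ n := by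
  have h0 := gInv_pos
  have h1 := gInv_gt
  have h2 := gInv_lt
  induction n generalizing P with
  | zero =>
    have h3 := slopeSeq_mem 1 P
    have h4 := slopeSeq_mem 0 P
    have : 0 ≤ |P.2.2 - P.2.1| := abs_nonneg _
    rw [abs_le]; simp only [pow_zero, zero_add]; constructor <;> linarith
  | succ n ih =>
    set Q := renorm P with hQ
    have h3 := ih Q
    have ht := renorm_height_sub P
    rw [← hQ] at ht
    rw [ht] at h3
    have h4 : slopeSeq (n + 1 + 1) P - slopeSeq (n + 1) P =
      -(gInv * ((gDer (leafSeq (n + 1) Q) - gDer (leafSeq n Q)) * slopeSeq (n + 1) Q +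
        gDer (leafSeq n Q) * (slopeSeq (n + 1) Q - slopeSeq n Q))) := by
      rw [slopeSeq, slopeSeq.eq_def (n + 1) P]; simp only [← hQ]; ring
    have h5 := abs_leafSeq_succ_sub n Q
    rw [ht] at h5
    have h6 := (abs_gDer_sub_le (leafSeq (n + 1) Q) (leafSeq n Q))
    have h7 : |(gDer (leafSeq (n + 1) Q) - gDer (leafSeq n Q)) * slopeSeq (n + 1) Q|
        ≤ 4 * |leafSeq (n + 1) Q - leafSeq n Q| * 1 := by
      rw [abs_mul]; gcongr; exact abs_slopeSeq_le _ _
    have h8 : |gDer (leafSeq n Q) * (slopeSeq (n + 1) Q - slopeSeq n Q)|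
        ≤ 5 / 4 * |slopeSeq (n + 1) Q - slopeSeq n Q| := by
      rw [abs_mul, abs_of_pos (gDer_pos _)]; gcongr; exact gDer_upper _
    rw [h4, abs_neg, abs_mul, abs_of_pos h0]
    set T := |P.2.2 - P.2.1|
    have hT : 0 ≤ T := abs_nonneg _
    set s : ℝ := (9 / 10) ^ n with hs
    have hs0 : 0 < s := by positivity
    have h9 : 13 * (1 + gInv * T) * s ≤ 13 * (1 + T) * s := by gcongr; nlinarith
    have h10 : gInv * T * s ≤ (6181 / 10000) * ((1 + T) * s) := by
      rw [mul_assoc]; gcongr; linarith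
    calc _ ≤ gInv * (4 * (6181 / 10000 * ((1 + T) * s)) + 5 / 4 * (13 * (1 + T) * s)) := by
          gcongr
          refine (abs_add_le _ _).trans ?_
          linarith
      _ ≤ 6181 / 10000 * (4 * (6181 / 10000 * ((1 + T) * s)) + 5 / 4 * (13 * (1 + T) * s)) := by
          gcongr
      _ ≤ _ := by
          rw [pow_succ, ← hs]
          have : 0 ≤ (1 + T) * s := by positivity
          linarith

lemma abs_logSeq_succ_sub (n : ℕ) (P : ℝ × ℝ × ℝ) :
    |logSeq (n + 1) P - logSeq n P| ≤ 1200 * |P.2.2 - P.2.1| * (9 / 10) ^ n := by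
  have h0 := gInv_pos
  have h1 := gInv_gt
  have h2 := gInv_lt
  induction n generalizing P with
  | zero =>
    have h3 := abs_log_gDer_sub_le ((renorm P).1 +
      leafSlope * ((renorm P).2.2 - (renorm P).2.1)) (renorm P).1
    have hl : leafSlope * gInv ≤ 1 := by unfold leafSlope; nlinarith [gInv_sq]
    have hl0 : 0 < leafSlope := by unfold leafSlope; linarith
    rw [add_sub_cancel_left, abs_mul, renorm_height_sub, abs_of_pos hl0] at h3
    simp only [logSeq, leafSeq, add_zero, sub_zero, pow_zero, mul_one]
    refine h3.trans ?_
    nlinarith [abs_nonneg (P.2.2 - P.2.1)]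
  | succ n ih =>
    set Q := renorm P with hQ
    have h3 := ih Q
    have ht := renorm_height_sub P
    rw [← hQ] at ht
    rw [ht] at h3
    have h4 : logSeq (n + 1 + 1) P - logSeq (n + 1) P =
        (Real.log (gDer (leafSeq (n + 1) Q)) - Real.log (gDer (leafSeq n Q))) +
        (logSeq (n + 1) Q - logSeq n Q) := by
      rw [logSeq, logSeq.eq_def (n + 1) P]; simp only [← hQ]; ring
    have h5 := abs_leafSeq_succ_sub n Q
    rw [ht] at h5
    have h6 := abs_log_gDer_sub_le (leafSeq (n + 1) Q) (leafSeq n Q)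
    rw [h4]
    refine (abs_add_le _ _).trans ?_
    rw [pow_succ]
    have h7 : 0 ≤ |P.2.2 - P.2.1| * (9 / 10) ^ n := by positivity
    nlinarith

lemma tendsto_limUnder_of_geometric {f : ℕ → ℝ} {C : ℝ}
    (h : ∀ n, |f (n + 1) - f n| ≤ C * (9 / 10) ^ n) :
    Tendsto f atTop (𝓝 (limUnder atTop f)) ∧
      ∀ n, |f n - limUnder atTop f| ≤ 10 * C * (9 / 10) ^ n := by
  have h' : ∀ n, dist (f n) (f (n + 1)) ≤ C * (9 / 10) ^ n := fun n => by
    rw [dist_comm]; exact h n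
  have ht : Tendsto f atTop (𝓝 (limUnder atTop f)) :=
    tendsto_nhds_limUnder (cauchySeq_tendsto_of_complete
      (cauchySeq_of_le_geometric (9 / 10) C (by norm_num) h'))
  refine ⟨ht, fun n => ?_⟩
  have := dist_le_of_le_geometric_of_tendsto (9 / 10) C (by norm_num) h' ht n
  rw [Real.dist_eq] at this
  refine this.trans_eq ?_
  ring

/-- The holonomy: `leaf (x, a, b)` is the first coordinate at height `b` of the leaf
through `(x, a)`. -/
def leaf (P : ℝ × ℝ × ℝ) : ℝ := limUnder atTop fun n => leafSeq n P

/-- The derivative of `leaf` in the final height. -/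
def leafSpeed (P : ℝ × ℝ × ℝ) : ℝ := limUnder atTop fun n => slopeSeq n P

/-- The logarithm of the derivative of `leaf` in the first coordinate. -/
def leafLog (P : ℝ × ℝ × ℝ) : ℝ := limUnder atTop fun n => logSeq n P

lemma tendsto_leafSeq (P : ℝ × ℝ × ℝ) : Tendsto (fun n => leafSeq n P) atTop (𝓝 (leaf P)) :=
  (tendsto_limUnder_of_geometric fun n => abs_leafSeq_succ_sub n P).1

lemma abs_leafSeq_sub (n : ℕ) (P : ℝ × ℝ × ℝ) :
    |leafSeq n P - leaf P| ≤ 10 * |P.2.2 - P.2.1| * (9 / 10) ^ n :=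
  (tendsto_limUnder_of_geometric (f := fun n => leafSeq n P) fun n => abs_leafSeq_succ_sub n P).2 n

lemma tendsto_slopeSeq (P : ℝ × ℝ × ℝ) : Tendsto (fun n => slopeSeq n P) atTop (𝓝 (leafSpeed P)) :=
  (tendsto_limUnder_of_geometric fun n => abs_slopeSeq_succ_sub n P).1

lemma abs_slopeSeq_sub (n : ℕ) (P : ℝ × ℝ × ℝ) :
    |slopeSeq n P - leafSpeed P| ≤ 10 * (13 * (1 + |P.2.2 - P.2.1|)) * (9 / 10) ^ n :=
  (tendsto_limUnder_of_geometric (f := fun n => slopeSeq n P) fun n => abs_slopeSeq_succ_sub n P).2 n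

lemma abs_logSeq_sub (n : ℕ) (P : ℝ × ℝ × ℝ) :
    |logSeq n P - leafLog P| ≤ 10 * (1200 * |P.2.2 - P.2.1|) * (9 / 10) ^ n :=
  (tendsto_limUnder_of_geometric (f := fun n => logSeq n P) fun n => abs_logSeq_succ_sub n P).2 n

lemma abs_leafLog_le (P : ℝ × ℝ × ℝ) : |leafLog P| ≤ 12000 * |P.2.2 - P.2.1| := by
  have := abs_logSeq_sub 0 P
  simp only [logSeq, zero_sub, abs_neg, pow_zero] at this
  linarith

lemma abs_logSeq_le (n : ℕ) (P : ℝ × ℝ × ℝ) : |logSeq n P| ≤ 24000 * |P.2.2 - P.2.1| := by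
  have h1 := abs_leafLog_le P
  have h2 := abs_logSeq_sub n P
  have h3 : ((9 : ℝ) / 10) ^ n ≤ 1 := pow_le_one₀ (by norm_num) (by norm_num)
  have h4 := abs_add_le (logSeq n P - leafLog P) (leafLog P)
  rw [sub_add_cancel] at h4
  nlinarith [abs_nonneg (P.2.2 - P.2.1)]

lemma leafSpeed_mem (P : ℝ × ℝ × ℝ) : 1 / 10 ≤ leafSpeed P ∧ leafSpeed P ≤ gInv :=
  ⟨ge_of_tendsto' (tendsto_slopeSeq P) fun n => (slopeSeq_mem n P).1,
    le_of_tendsto' (tendsto_slopeSeq P) fun n => (slopeSeq_mem n P).2⟩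

lemma abs_exp_sub_exp_le {x y M : ℝ} (hx : x ≤ M) (hy : y ≤ M) :
    |Real.exp x - Real.exp y| ≤ Real.exp M * |x - y| := by
  have := Convex.norm_image_sub_le_of_norm_hasDerivWithin_le (f := Real.exp) (f' := Real.exp)
    (s := Set.Iic M) (C := Real.exp M) (x := y) (y := x)
    (fun z _ => (Real.hasDerivAt_exp z).hasDerivWithinAt)
    (fun z hz => by
      rw [Real.norm_eq_abs, abs_of_pos (Real.exp_pos z)]; exact Real.exp_le_exp.2 hz)
    (convex_Iic M) hy hx
  simpa using this

/-- The linear map with the three given partial derivatives. -/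
def triForm (v u w : ℝ) : ℝ × ℝ × ℝ →L[ℝ] ℝ :=
  v • ContinuousLinearMap.fst ℝ ℝ (ℝ × ℝ) +
    u • (ContinuousLinearMap.fst ℝ ℝ ℝ).comp (ContinuousLinearMap.snd ℝ ℝ (ℝ × ℝ)) +
    w • (ContinuousLinearMap.snd ℝ ℝ ℝ).comp (ContinuousLinearMap.snd ℝ ℝ (ℝ × ℝ))

@[simp] lemma triForm_apply (v u w : ℝ) (z : ℝ × ℝ × ℝ) :
    triForm v u w z = v * z.1 + u * z.2.1 + w * z.2.2 := by
  simp [triForm]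

lemma norm_triForm_sub_le (v u w v' u' w' : ℝ) :
    ‖triForm v u w - triForm v' u' w'‖ ≤ |v - v'| + |u - u'| + |w - w'| := by
  refine ContinuousLinearMap.opNorm_le_bound _ (by positivity) fun z => ?_
  have h1 : |z.1| ≤ ‖z‖ := norm_fst_le z
  have h2 : |z.2.1| ≤ ‖z‖ := (norm_fst_le z.2).trans (norm_snd_le z)
  have h3 : |z.2.2| ≤ ‖z‖ := (norm_snd_le z.2).trans (norm_snd_le z)
  have h : (triForm v u w - triForm v' u' w') z =
      (v - v') * z.1 + (u - u') * z.2.1 + (w - w') * z.2.2 := by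
    simp; ring
  rw [h, Real.norm_eq_abs]
  calc _ ≤ |(v - v') * z.1| + |(u - u') * z.2.1| + |(w - w') * z.2.2| := abs_add_three _ _ _
    _ ≤ |v - v'| * ‖z‖ + |u - u'| * ‖z‖ + |w - w'| * ‖z‖ := by
      simp only [abs_mul]; gcongr
    _ = _ := by ring

lemma continuous_renorm : Continuous renorm := by
  have := continuous_gSymm
  unfold renorm; fun_prop

lemma continuous_leafSeq (n : ℕ) : Continuous (leafSeq n) := by
  have h1 := continuous_gMap
  have h2 := continuous_renorm
  induction n with
  | zero => exact (by fun_prop : Continuous fun P : ℝ × ℝ × ℝ => P.1 + leafSlope * (P.2.2 - P.2.1))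
  | succ n ih => exact (by fun_prop : Continuous fun P : ℝ × ℝ × ℝ =>
      gInv * P.2.2 - gMap (leafSeq n (renorm P)))

lemma continuous_slopeSeq (n : ℕ) : Continuous (slopeSeq n) := by
  have h1 := continuous_gDer
  have h2 := continuous_renorm
  induction n with
  | zero => exact continuous_const
  | succ n ih =>
    have := continuous_leafSeq n
    exact (by fun_prop : Continuous fun P : ℝ × ℝ × ℝ =>
      gInv - gInv * gDer (leafSeq n (renorm P)) * slopeSeq n (renorm P))

lemma continuous_logSeq (n : ℕ) : Continuous (logSeq n) := by
  have h1 : Continuous fun x => Real.log (gDer x) :=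
    continuous_gDer.log fun x => (gDer_pos x).ne'
  have h2 := continuous_renorm
  induction n with
  | zero => exact continuous_const
  | succ n ih =>
    have h3 := h1.comp ((continuous_leafSeq n).comp h2)
    have h4 := h1.comp h2.fst
    exact (h3.sub h4).add (ih.comp h2)

lemma hasFDerivAt_renorm (P : ℝ × ℝ × ℝ) :
    HasFDerivAt renorm ((triForm (-(gDer (renorm P).1)⁻¹) (gInv * (gDer (renorm P).1)⁻¹) 0).prod
      ((triForm 0 gInv 0).prod (triForm 0 0 gInv))) P := by
  have h1 : HasFDerivAt (fun P : ℝ × ℝ × ℝ => P.1) (triForm 1 0 0) P := by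
    refine hasFDerivAt_fst.congr_fderiv ?_
    ext <;> simp
  have h2 : HasFDerivAt (fun P : ℝ × ℝ × ℝ => gInv * P.2.1) (triForm 0 gInv 0) P := by
    convert (triForm 0 gInv 0).hasFDerivAt using 1
    ext; simp
  have h3 : HasFDerivAt (fun P : ℝ × ℝ × ℝ => gInv * P.2.2) (triForm 0 0 gInv) P := by
    convert (triForm 0 0 gInv).hasFDerivAt using 1
    ext; simp
  have h4 := (hasDerivAt_gSymm (gInv * P.2.1 - P.1)).comp_hasFDerivAt P (h2.sub h1)
  have h5 := h4.prodMk (h2.prodMk h3)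
  refine h5.congr_fderiv ?_
  ext <;> simp [renorm, mul_comm]

/-- The derivative of `leafSeq n`. -/
def leafSeqDeriv (n : ℕ) (P : ℝ × ℝ × ℝ) : ℝ × ℝ × ℝ →L[ℝ] ℝ :=
  triForm (Real.exp (logSeq n P)) (-Real.exp (logSeq n P) * slopeSeq n (P.1, P.2.1, P.2.1))
    (slopeSeq n P)

lemma hasFDerivAt_leafSeq (n : ℕ) (P : ℝ × ℝ × ℝ) :
    HasFDerivAt (leafSeq n) (leafSeqDeriv n P) P := by
  induction n generalizing P with
  | zero =>
    have h := (triForm 1 (-leafSlope) leafSlope).hasFDerivAt (x := P)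
    convert h using 1
    · ext P; simp only [leafSeq, triForm_apply]; ring
    · simp [leafSeqDeriv, logSeq, slopeSeq]
  | succ n ih =>
    have h1 := (hasDerivAt_gMap (leafSeq n (renorm P))).comp_hasFDerivAt P
      ((ih (renorm P)).comp P (hasFDerivAt_renorm P))
    have h3 : HasFDerivAt (fun P : ℝ × ℝ × ℝ => gInv * P.2.2) (triForm 0 0 gInv) P := by
      convert (triForm 0 0 gInv).hasFDerivAt using 1
      ext; simp
    refine (h3.sub h1).congr_fderiv ?_
    have h4 := gDer_pos (leafSeq n (renorm P))
    have h5 := gDer_pos (renorm P).1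
    have h6 : Real.exp (logSeq (n + 1) P) =
        gDer (leafSeq n (renorm P)) / gDer (renorm P).1 * Real.exp (logSeq n (renorm P)) := by
      rw [logSeq, Real.exp_add, Real.exp_sub, Real.exp_log h4, Real.exp_log h5]
    have h7 : slopeSeq (n + 1) (P.1, P.2.1, P.2.1) = gInv - gInv * gDer (renorm P).1 *
        slopeSeq n ((renorm P).1, (renorm P).2.1, (renorm P).2.1) := by
      have : renorm (P.1, P.2.1, P.2.1) = ((renorm P).1, (renorm P).2.1, (renorm P).2.1) := rfl
      rw [slopeSeq, this, leafSeq_self]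
    rw [leafSeqDeriv.eq_def (n + 1), h6, h7, slopeSeq]
    ext
    all_goals
      simp [leafSeqDeriv]
      try field_simp
      try ring

/-- The derivative of `leaf`. -/
def leafDeriv (P : ℝ × ℝ × ℝ) : ℝ × ℝ × ℝ →L[ℝ] ℝ :=
  triForm (Real.exp (leafLog P)) (-Real.exp (leafLog P) * leafSpeed (P.1, P.2.1, P.2.1)) (leafSpeed P)

lemma norm_leafSeqDeriv_sub_le (n : ℕ) (P : ℝ × ℝ × ℝ) :
    ‖leafSeqDeriv n P - leafDeriv P‖ ≤ (10000000 * (1 + |P.2.2 - P.2.1|) *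
      Real.exp (24000 * |P.2.2 - P.2.1|)) * (9 / 10) ^ n := by
  unfold leafSeqDeriv leafDeriv
  refine (norm_triForm_sub_le _ _ _ _ _ _).trans ?_
  set T := |P.2.2 - P.2.1|
  have hT : 0 ≤ T := abs_nonneg _
  set s : ℝ := (9 / 10) ^ n with hs
  have hs0 : 0 < s := by positivity
  set E := Real.exp (24000 * T)
  have hE : 1 ≤ E := Real.one_le_exp (by positivity)
  have h1 : |Real.exp (logSeq n P) - Real.exp (leafLog P)| ≤ E * (12000 * T * s) := by
    refine (abs_exp_sub_exp_le ((le_abs_self _).trans (abs_logSeq_le n P))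
      ((le_abs_self _).trans ((abs_leafLog_le P).trans ?_))).trans ?_
    · linarith
    · gcongr; linarith [abs_logSeq_sub n P]
  have h2 : |slopeSeq n P - leafSpeed P| ≤ 130 * (1 + T) * s := by
    linarith [abs_slopeSeq_sub n P]
  have h3 : |slopeSeq n (P.1, P.2.1, P.2.1) - leafSpeed (P.1, P.2.1, P.2.1)| ≤ 130 * s := by
    have := abs_slopeSeq_sub n (P.1, P.2.1, P.2.1)
    simp only [sub_self, abs_zero] at this
    linarith
  have h4 : |-Real.exp (logSeq n P) * slopeSeq n (P.1, P.2.1, P.2.1) -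
      -Real.exp (leafLog P) * leafSpeed (P.1, P.2.1, P.2.1)| ≤
      E * (12000 * T * s) * 1 + E * (130 * s) := by
    have : -Real.exp (logSeq n P) * slopeSeq n (P.1, P.2.1, P.2.1) -
      -Real.exp (leafLog P) * leafSpeed (P.1, P.2.1, P.2.1) =
      -((Real.exp (logSeq n P) - Real.exp (leafLog P)) * slopeSeq n (P.1, P.2.1, P.2.1) +
      Real.exp (leafLog P) * (slopeSeq n (P.1, P.2.1, P.2.1) - leafSpeed (P.1, P.2.1, P.2.1))) := by
      ring
    rw [this, abs_neg]
    refine (abs_add_le _ _).trans ?_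
    rw [abs_mul, abs_mul, Real.abs_exp]
    gcongr
    · exact abs_slopeSeq_le _ _
    · refine Real.exp_le_exp.2 ((le_abs_self _).trans ((abs_leafLog_le P).trans ?_))
      linarith
  have h5 : 130 * (1 + T) * s ≤ E * (130 * (1 + T) * s) :=
    le_mul_of_one_le_left (by positivity) hE
  have h6 : 0 ≤ E * T * s := by positivity
  have h7 : 0 ≤ E * s := by positivity
  nlinarith

lemma tendstoLocallyUniformly_of_geometric {α F : Type*} [TopologicalSpace α]
    [SeminormedAddCommGroup F] {f : ℕ → α → F} {g : α → F} {K : α → ℝ} (hK : Continuous K)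
    (h : ∀ n x, ‖f n x - g x‖ ≤ K x * (9 / 10) ^ n) :
    TendstoLocallyUniformly f g atTop := by
  rw [Metric.tendstoLocallyUniformly_iff]
  intro ε hε x
  refine ⟨{y | K y < K x + 1}, hK.continuousAt.eventually (gt_mem_nhds (by linarith)), ?_⟩
  have h1 : Tendsto (fun n : ℕ => (K x + 1) * (9 / 10 : ℝ) ^ n) atTop (𝓝 ((K x + 1) * 0)) :=
    (tendsto_pow_atTop_nhds_zero_of_lt_one (by norm_num) (by norm_num)).const_mul _
  rw [mul_zero] at h1
  filter_upwards [h1.eventually (gt_mem_nhds hε)] with n hn y hy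
  rw [dist_comm, dist_eq_norm]
  refine (h n y).trans_lt (lt_of_le_of_lt ?_ hn)
  gcongr

lemma tendstoLocallyUniformly_leafSeq : TendstoLocallyUniformly leafSeq leaf atTop :=
  tendstoLocallyUniformly_of_geometric (K := fun P => 10 * |P.2.2 - P.2.1|) (by fun_prop)
    abs_leafSeq_sub

lemma tendstoLocallyUniformly_leafSeqDeriv :
    TendstoLocallyUniformly leafSeqDeriv leafDeriv atTop :=
  tendstoLocallyUniformly_of_geometric (by fun_prop) norm_leafSeqDeriv_sub_le

lemma continuous_leaf : Continuous leaf :=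
  tendstoLocallyUniformly_leafSeq.continuous (Eventually.of_forall continuous_leafSeq).frequently

lemma continuous_leafDeriv : Continuous leafDeriv := by
  refine tendstoLocallyUniformly_leafSeqDeriv.continuous
    (Eventually.of_forall fun n => ?_).frequently
  have h1 := continuous_logSeq n
  have h2 := continuous_slopeSeq n
  have h3 : Continuous fun P : ℝ × ℝ × ℝ => slopeSeq n (P.1, P.2.1, P.2.1) := by fun_prop
  unfold leafSeqDeriv triForm
  fun_prop

lemma hasFDerivAt_leaf (P : ℝ × ℝ × ℝ) : HasFDerivAt leaf (leafDeriv P) P :=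
  hasFDerivAt_of_tendstoLocallyUniformlyOn isOpen_univ
    (tendstoLocallyUniformlyOn_univ.2 tendstoLocallyUniformly_leafSeqDeriv)
    (fun n x _ => hasFDerivAt_leafSeq n x) (fun x _ => tendsto_leafSeq x) (mem_univ P)

lemma contDiff_leaf : ContDiff ℝ 1 leaf :=
  contDiff_one_iff_hasFDerivAt.2 ⟨leafDeriv, continuous_leafDeriv, hasFDerivAt_leaf⟩

lemma leaf_self (x a : ℝ) : leaf (x, a, a) = x :=
  tendsto_nhds_unique (tendsto_leafSeq _) (by simp only [leafSeq_self]; exact tendsto_const_nhds)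

lemma leaf_renorm (P : ℝ × ℝ × ℝ) : leaf P = gInv * P.2.2 - gMap (leaf (renorm P)) :=
  tendsto_nhds_unique ((tendsto_add_atTop_iff_nat 1).2 (tendsto_leafSeq P))
    (((continuous_gMap.tendsto _).comp (tendsto_leafSeq (renorm P))).const_sub _)

lemma renorm_leafSeq (n : ℕ) (x a c b : ℝ) :
    renorm (leafSeq (n + 1) (x, a, c), c, b) =
      (leafSeq n (renorm (x, a, c)), gInv * c, gInv * b) := by
  simp only [renorm, leafSeq, sub_sub_cancel, gSymm_gMap]

lemma leafSeq_trans (n : ℕ) (x a c b : ℝ) :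
    leafSeq n (leafSeq n (x, a, c), c, b) = leafSeq n (x, a, b) := by
  induction n generalizing x a c b with
  | zero => simp only [leafSeq]; ring
  | succ n ih =>
    have h := ih (renorm (x, a, c)).1 (gInv * a) (gInv * c) (gInv * b)
    rw [leafSeq, renorm_leafSeq]
    simp only [renorm, leafSeq] at h ⊢
    rw [h]

lemma leaf_trans (x a c b : ℝ) : leaf (leaf (x, a, c), c, b) = leaf (x, a, b) := by
  have h1 : Tendsto (fun n => (leafSeq n (x, a, c), c, b)) atTop (𝓝 (leaf (x, a, c), c, b)) :=
    (tendsto_leafSeq _).prodMk_nhds tendsto_const_nhds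
  have h2 := tendstoLocallyUniformly_leafSeq.tendsto_comp continuous_leaf.continuousAt h1
  simp only [leafSeq_trans] at h2
  exact tendsto_nhds_unique h2 (tendsto_leafSeq _)

lemma leafSeq_shift (k : ℕ) (x a b : ℝ) (m n : ℤ) :
    leafSeq k (x + m, a + ((1 + gInv) * m + n), b + ((1 + gInv) * m + n)) =
      leafSeq k (x, a, b) + m := by
  have hg := gInv_sq
  induction k generalizing x a b m n with
  | zero => simp only [leafSeq]; ring
  | succ k ih =>
    have h := ih (renorm (x, a, b)).1 (gInv * a) (gInv * b) n (m - n)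
    have key : ∀ c : ℝ, gInv * (c + ((1 + gInv) * m + n)) =
        gInv * c + ((1 + gInv) * n + ((m - n : ℤ) : ℝ)) := by
      intro c; push_cast; linear_combination (m : ℝ) * hg
    have h1 : renorm (x + m, a + ((1 + gInv) * m + n), b + ((1 + gInv) * m + n)) =
        ((renorm (x, a, b)).1 + n, gInv * a + ((1 + gInv) * n + ((m - n : ℤ) : ℝ)),
          gInv * b + ((1 + gInv) * n + ((m - n : ℤ) : ℝ))) := by
      simp only [renorm, key, Prod.mk.injEq, and_true]
      rw [← gSymm_add_int]
      congr 1
      push_cast; ring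
    rw [leafSeq, h1, h, gMap_add_int, leafSeq]
    simp only [key]
    simp only [renorm]
    push_cast; ring

lemma leaf_shift (x a b : ℝ) (m n : ℤ) :
    leaf (x + m, a + ((1 + gInv) * m + n), b + ((1 + gInv) * m + n)) = leaf (x, a, b) + m :=
  tendsto_nhds_unique (tendsto_leafSeq _) (by
    simp only [leafSeq_shift]; exact (tendsto_leafSeq _).add_const _)

lemma abs_leafSeq_sub_linear (n : ℕ) (P : ℝ × ℝ × ℝ) :
    |leafSeq n P - P.1 - leafSlope * (P.2.2 - P.2.1)| ≤ 2 := by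
  have h0 := gInv_pos
  have h1 := gInv_gt
  have h2 := gInv_lt
  induction n generalizing P with
  | zero => simp [leafSeq]
  | succ n ih =>
    set Q := renorm P with hQ
    have h3 := ih Q
    have h4 := abs_gMap_sub_le (leafSeq n Q)
    have h5 := abs_gMap_sub_le Q.1
    have h6 := gMap_renorm P
    have h7 : leafSlope = gInv - gInv ^ 2 * leafSlope := by
      unfold leafSlope; linear_combination (2 * gInv - 1) / 5 * gInv_sq
    have h8 : leafSeq (n + 1) P - P.1 - leafSlope * (P.2.2 - P.2.1) =
        -gInv * (leafSeq n Q - Q.1 - leafSlope * (Q.2.2 - Q.2.1)) -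
        (gMap (leafSeq n Q) - gInv * leafSeq n Q) + (gMap Q.1 - gInv * Q.1) := by
      have e1 : Q.2.1 = gInv * P.2.1 := rfl
      have e2 : Q.2.2 = gInv * P.2.2 := rfl
      rw [leafSeq, ← hQ, e1, e2]
      rw [← hQ] at h6
      rw [h6]
      linear_combination -(P.2.2 - P.2.1) * h7
    rw [h8]
    refine (abs_add_le _ _).trans ((add_le_add_left (abs_sub _ _) _).trans ?_)
    rw [abs_mul, abs_neg, abs_of_pos h0]
    nlinarith

lemma abs_leaf_sub_linear (x a b : ℝ) : |leaf (x, a, b) - x - leafSlope * (b - a)| ≤ 2 :=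
  le_of_tendsto' (((tendsto_leafSeq _).sub_const _).sub_const _).abs
    fun n => abs_leafSeq_sub_linear n (x, a, b)

lemma hasDerivAt_leaf_height (x a b : ℝ) :
    HasDerivAt (fun b => leaf (x, a, b)) (leafSpeed (x, a, b)) b := by
  have h1 : HasDerivAt (fun b : ℝ => (x, a, b)) (0, 0, 1) b :=
    (hasDerivAt_const _ _).prodMk ((hasDerivAt_const _ _).prodMk (hasDerivAt_id _))
  have h2 := (hasFDerivAt_leaf (x, a, b)).comp_hasDerivAt b h1
  refine h2.congr_deriv ?_
  simp [leafDeriv]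

lemma hasDerivAt_leaf_fst (x a b : ℝ) :
    HasDerivAt (fun x => leaf (x, a, b)) (Real.exp (leafLog (x, a, b))) x := by
  have h1 : HasDerivAt (fun x : ℝ => (x, a, b)) (1, 0, 0) x :=
    (hasDerivAt_id _).prodMk ((hasDerivAt_const _ _).prodMk (hasDerivAt_const _ _))
  have h2 := (hasFDerivAt_leaf (x, a, b)).comp_hasDerivAt x h1
  refine h2.congr_deriv ?_
  simp [leafDeriv]

lemma leafSpeed_pos (P : ℝ × ℝ × ℝ) : 0 < leafSpeed P :=
  lt_of_lt_of_le (by norm_num) (leafSpeed_mem P).1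

lemma strictMono_leaf_height (x a : ℝ) : StrictMono fun b => leaf (x, a, b) :=
  strictMono_of_hasDerivAt_pos (hasDerivAt_leaf_height x a) fun _ => leafSpeed_pos _

lemma strictMono_leaf_fst (a b : ℝ) : StrictMono fun x => leaf (x, a, b) :=
  strictMono_of_hasDerivAt_pos (fun x => hasDerivAt_leaf_fst x a b) fun _ => Real.exp_pos _

lemma abs_leaf_sub_le (x a b : ℝ) : |leaf (x, a, b) - x| ≤ |b - a| := by
  have := Convex.norm_image_sub_le_of_norm_hasDerivWithin_le (f := fun b => leaf (x, a, b))
    (f' := fun b => leafSpeed (x, a, b)) (s := Set.univ) (C := 1) (x := a) (y := b)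
    (fun z _ => (hasDerivAt_leaf_height x a z).hasDerivWithinAt)
    (fun z _ => by
      rw [Real.norm_eq_abs, abs_of_pos (leafSpeed_pos _)]
      linarith [(leafSpeed_mem (x, a, z)).2, gInv_lt])
    convex_univ (Set.mem_univ _) (Set.mem_univ _)
  simpa [leaf_self] using this

lemma leafSlope_gt : 2 / 5 < leafSlope := by
  have := gInv_gt
  unfold leafSlope; linarith

lemma exists_leaf_eq (x a z : ℝ) : ∃ b, leaf (x, a, b) = z := by
  have h := leafSlope_gt
  have hc : Continuous fun b => leaf (x, a, b) := continuous_leaf.comp (by fun_prop)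
  refine hc.surjective ?_ ?_ z
  · refine tendsto_atTop_mono (f := fun b => leafSlope * b + (x - leafSlope * a - 2))
      (fun b => ?_) ?_
    · linarith [(abs_le.1 (abs_leaf_sub_linear x a b)).1]
    · exact tendsto_atTop_add_const_right _ _ (tendsto_id.const_mul_atTop (by linarith))
  · refine tendsto_atBot_mono (g := fun b => leaf (x, a, b))
      (f := fun b => leafSlope * b + (x - leafSlope * a + 2)) (fun b => ?_) ?_
    · linarith [(abs_le.1 (abs_leaf_sub_linear x a b)).2]
    · exact tendsto_atBot_add_const_right _ _ (tendsto_id.const_mul_atBot (by linarith))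

/-- The height at which the leaf through `(0, s)` reaches first coordinate `1`. -/
def hitHeight (s : ℝ) : ℝ := (exists_leaf_eq 0 s 1).choose

lemma leaf_hitHeight (s : ℝ) : leaf (0, s, hitHeight s) = 1 := (exists_leaf_eq 0 s 1).choose_spec

lemma hitHeight_eq {s b : ℝ} (h : leaf (0, s, b) = 1) : hitHeight s = b :=
  (strictMono_leaf_height 0 s).injective (by simp only [leaf_hitHeight, h])

lemma strictMono_hitHeight : StrictMono hitHeight := by
  intro s s' h
  have h1 : (0 : ℝ) < leaf (0, s, s') := by
    have := strictMono_leaf_height 0 s h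
    simpa [leaf_self] using this
  have h2 := strictMono_leaf_fst s' (hitHeight s') h1
  simp only [leaf_trans, leaf_hitHeight s'] at h2
  rw [← leaf_hitHeight s] at h2
  exact (strictMono_leaf_height 0 s).lt_iff_lt.1 h2

lemma surjective_hitHeight : Function.Surjective hitHeight := by
  intro b
  obtain ⟨s, hs⟩ := exists_leaf_eq 1 b 0
  refine ⟨s, hitHeight_eq ?_⟩
  rw [← hs, leaf_trans, leaf_self]

lemma hitHeight_add_one (s : ℝ) : hitHeight (s + 1) = hitHeight s + 1 := by
  apply hitHeight_eq
  have := leaf_shift 0 s (hitHeight s) 0 1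
  simpa [leaf_hitHeight] using this

/-- The first return map to the vertical circle. -/
def returnLift : CircleDeg1Lift where
  toFun s := hitHeight s - (1 + gInv)
  monotone' s s' h := by
    have := strictMono_hitHeight.monotone h
    simpa using this
  map_add_one' s := by rw [hitHeight_add_one]; ring

lemma returnLift_apply (s : ℝ) : returnLift s = hitHeight s - (1 + gInv) := rfl

lemma isUnit_returnLift : IsUnit returnLift := by
  rw [CircleDeg1Lift.isUnit_iff_bijective]
  refine ⟨fun s s' h => strictMono_hitHeight.injective ?_, fun b => ?_⟩
  · simpa [returnLift_apply] using h
  · obtain ⟨s, hs⟩ := surjective_hitHeight (b + (1 + gInv))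
    exact ⟨s, by rw [returnLift_apply, hs]; ring⟩

lemma leaf_returnLift_iterate (n : ℕ) :
    leaf (0, 0, (returnLift ^ n) 0 + (1 + gInv) * n) = n := by
  induction n with
  | zero => simp [leaf_self]
  | succ n ih =>
    rw [← leaf_trans _ _ ((returnLift ^ n) 0 + (1 + gInv) * n), ih]
    have h := leaf_shift 0 ((returnLift ^ n) 0) (hitHeight ((returnLift ^ n) 0)) n 0
    rw [leaf_hitHeight] at h
    rw [pow_succ', CircleDeg1Lift.mul_apply, returnLift_apply]
    push_cast at h ⊢
    refine Eq.trans ?_ (h.trans (add_comm _ _))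
    congr 1
    refine Prod.ext (by simp) (Prod.ext (by simp) ?_)
    simp only
    ring

lemma translationNumber_returnLift : returnLift.translationNumber = gInv := by
  rw [← CircleDeg1Lift.translationNumber_translate gInv]
  refine CircleDeg1Lift.translationNumber_eq_of_dist_bounded 5 fun n => ?_
  rw [← Units.val_pow_eq_pow_val, CircleDeg1Lift.translate_pow,
    CircleDeg1Lift.translate_apply, add_zero, Real.dist_eq]
  have h := abs_leaf_sub_linear 0 0 ((returnLift ^ n) 0 + (1 + gInv) * n)
  rw [leaf_returnLift_iterate] at h
  have h1 : leafSlope * (1 + 2 * gInv) = 1 := by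
    unfold leafSlope; linear_combination 4 / 5 * gInv_sq
  have h2 : (n : ℝ) - 0 - leafSlope * ((returnLift ^ n) 0 + (1 + gInv) * n - 0) =
      -(leafSlope * ((returnLift ^ n) 0 - n * gInv)) := by
    linear_combination -(n : ℝ) * h1
  have h3 := leafSlope_gt
  rw [h2, abs_neg, abs_mul, abs_of_pos (by linarith)] at h
  nlinarith [abs_nonneg ((returnLift ^ n) 0 - n * gInv)]

/-! ### The flow on the plane -/

/-- The linear form whose level sets are preserved by the renormalization. -/
def height (v : ℝ × ℝ) : ℝ := (1 + gInv) * v.1 + v.2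

/-- The lift of the flow to the plane. -/
def planeFlow (t : ℝ) (v : ℝ × ℝ) : ℝ × ℝ :=
  (leaf (v.1, height v, height v + t),
    height v + t - (1 + gInv) * leaf (v.1, height v, height v + t))

/-- The lift of the renormalization to the plane. -/
def planeBack (v : ℝ × ℝ) : ℝ × ℝ :=
  (gSymm (gInv * v.2), v.1 + gInv * v.2 - (1 + gInv) * gSymm (gInv * v.2))

/-- The inverse of `planeBack`. -/
def planeFwd (v : ℝ × ℝ) : ℝ × ℝ :=
  (height v - gMap v.1, (1 + gInv) * gMap v.1)

lemma height_planeFlow (t : ℝ) (v : ℝ × ℝ) : height (planeFlow t v) = height v + t := by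
  simp only [height, planeFlow]; ring

lemma eq_of_height_eq {v w : ℝ × ℝ} (h1 : v.1 = w.1) (h2 : height v = height w) : v = w := by
  refine Prod.ext h1 ?_
  simp only [height, h1] at h2
  linarith

lemma planeFlow_zero (v : ℝ × ℝ) : planeFlow 0 v = v :=
  eq_of_height_eq (by simp [planeFlow, leaf_self]) (by rw [height_planeFlow, add_zero])

lemma planeFlow_add (t s : ℝ) (v : ℝ × ℝ) :
    planeFlow (t + s) v = planeFlow t (planeFlow s v) := by
  refine eq_of_height_eq ?_ (by simp only [height_planeFlow]; ring)
  simp only [planeFlow, ← leaf_trans v.1 (height v) (height v + s) (height v + (t + s))]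
  have := height_planeFlow s v
  simp only [planeFlow] at this
  rw [this, add_assoc, add_comm s t]

lemma height_shift (v : ℝ × ℝ) (m n : ℤ) :
    height (v + ((m : ℝ), (n : ℝ))) = height v + ((1 + gInv) * m + n) := by
  simp only [height, Prod.fst_add, Prod.snd_add]; ring

lemma planeFlow_shift (t : ℝ) (v : ℝ × ℝ) (m n : ℤ) :
    planeFlow t (v + ((m : ℝ), (n : ℝ))) = planeFlow t v + ((m : ℝ), (n : ℝ)) := by
  refine eq_of_height_eq ?_ (by simp only [height_planeFlow, height_shift]; ring)
  simp only [planeFlow, height_shift, Prod.fst_add]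
  rw [add_right_comm, leaf_shift]

lemma planeBack_shift (v : ℝ × ℝ) (m n : ℤ) :
    planeBack (v + ((m : ℝ), (n : ℝ))) = planeBack v + ((n : ℝ), ((m - n : ℤ) : ℝ)) := by
  simp only [planeBack, Prod.fst_add, Prod.snd_add, Prod.mk_add_mk, Prod.mk.injEq, mul_add,
    gSymm_add_int, true_and]
  push_cast; ring

lemma planeFwd_shift (v : ℝ × ℝ) (m n : ℤ) :
    planeFwd (v + ((m : ℝ), (n : ℝ))) = planeFwd v + (((m + n : ℤ) : ℝ), (m : ℝ)) := by
  simp only [planeFwd, height_shift, Prod.fst_add, Prod.mk_add_mk, Prod.mk.injEq,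
    gMap_add_int]
  push_cast
  constructor
  · ring
  · linear_combination (m : ℝ) * gInv_sq

lemma planeFwd_planeBack (v : ℝ × ℝ) : planeFwd (planeBack v) = v := by
  have := gInv_sq
  refine Prod.ext ?_ ?_
  · simp only [planeFwd, planeBack, height, gMap_gSymm]; ring
  · simp only [planeFwd, planeBack, gMap_gSymm]; linear_combination v.2 * this

lemma planeBack_planeFwd (v : ℝ × ℝ) : planeBack (planeFwd v) = v := by
  have h : gInv * (planeFwd v).2 = gMap v.1 := by
    simp only [planeFwd]; linear_combination gMap v.1 * gInv_sq
  refine Prod.ext ?_ ?_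
  · simp only [planeBack, h, gSymm_gMap]
  · simp only [planeBack, h, gSymm_gMap]; simp only [planeFwd, height]; ring

lemma height_planeBack (v : ℝ × ℝ) : height (planeBack v) = gInv * height v := by
  simp only [height, planeBack]; linear_combination -v.1 * gInv_sq

lemma planeBack_fst (v : ℝ × ℝ) : (planeBack v).1 = gSymm (gInv * height v - v.1) := by
  simp only [height, planeBack]
  congr 1; linear_combination -v.1 * gInv_sq

lemma planeBack_planeFlow (t : ℝ) (v : ℝ × ℝ) :
    planeBack (planeFlow t v) = planeFlow (gInv * t) (planeBack v) := by
  refine eq_of_height_eq ?_ ?_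
  · rw [planeBack_fst, height_planeFlow]
    simp only [planeFlow, height_planeBack, planeBack_fst]
    rw [leaf_renorm]
    simp only [renorm, sub_sub_cancel, gSymm_gMap, mul_add]
  · simp only [height_planeFlow, height_planeBack]; ring

lemma contDiff_planeFlow : ContDiff ℝ 1 (Function.uncurry planeFlow) := by
  have h1 : ContDiff ℝ 1 fun p : ℝ × ℝ × ℝ => leaf (p.2.1, height p.2, height p.2 + p.1) :=
    contDiff_leaf.comp (by unfold height; fun_prop)
  unfold Function.uncurry planeFlow
  refine h1.prodMk (ContDiff.sub ?_ (contDiff_const.mul h1))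
  unfold height; fun_prop

lemma contDiff_planeBack : ContDiff ℝ 1 planeBack := by
  have h1 : ContDiff ℝ 1 fun p : ℝ × ℝ => gSymm (gInv * p.2) :=
    contDiff_gSymm.comp (by fun_prop)
  exact h1.prodMk (ContDiff.sub (by fun_prop) (contDiff_const.mul h1))

lemma contDiff_planeFwd : ContDiff ℝ 1 planeFwd := by
  have h1 : ContDiff ℝ 1 fun p : ℝ × ℝ => gMap p.1 := contDiff_gMap.comp contDiff_fst
  exact ContDiff.prodMk (ContDiff.sub (by unfold height; fun_prop) h1) (contDiff_const.mul h1)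

lemma deriv_planeFlow (v : ℝ × ℝ) : deriv (fun t => planeFlow t v) 0 =
    (leafSpeed (v.1, height v, height v),
      1 - (1 + gInv) * leafSpeed (v.1, height v, height v)) := by
  have h0 : HasDerivAt (fun t => height v + t) 1 0 := (hasDerivAt_id 0).const_add _
  have h1 : HasDerivAt (fun t => leaf (v.1, height v, height v + t))
      (leafSpeed (v.1, height v, height v)) 0 := by
    have h := hasDerivAt_leaf_height v.1 (height v) (height v + 0)
    simpa [Function.comp_def] using h.comp 0 h0
  exact (h1.prodMk (h0.sub (h1.const_mul (1 + gInv)))).deriv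

/-! ### Passing to the torus -/

lemma coe_addCircle_eq_iff {x y : ℝ} :
    (x : AddCircle (1 : ℝ)) = y ↔ ∃ n : ℤ, y = x + n := by
  rw [eq_comm, ← sub_eq_zero, ← AddCircle.coe_sub, AddCircle.coe_eq_zero_iff]
  refine exists_congr fun n => ?_
  rw [zsmul_eq_mul, mul_one]
  constructor <;> intro h <;> linarith

lemma projT2_eq_iff {v w : ℝ × ℝ} :
    projT2 v = projT2 w ↔ ∃ m n : ℤ, w = v + ((m : ℝ), (n : ℝ)) := by
  simp only [projT2, coe_addCircle_eq_iff, Prod.ext_iff, Prod.fst_add,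
    Prod.snd_add, exists_and_left, exists_and_right]

lemma projT2_shift (v : ℝ × ℝ) (m n : ℤ) : projT2 (v + ((m : ℝ), (n : ℝ))) = projT2 v :=
  (projT2_eq_iff.2 ⟨m, n, rfl⟩).symm

lemma isOpenQuotientMap_projT2 : IsOpenQuotientMap projT2 :=
  IsOpenQuotientMap.prodMap (QuotientAddGroup.isOpenQuotientMap_mk)
    (QuotientAddGroup.isOpenQuotientMap_mk)

/-- The torus map induced by a map of the plane. -/
def descend (f : ℝ × ℝ → ℝ × ℝ) (X : T2) : T2 :=
  projT2 (f (Function.surjInv isOpenQuotientMap_projT2.surjective X))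

lemma descend_projT2 {f : ℝ × ℝ → ℝ × ℝ}
    (hf : ∀ v (m n : ℤ), ∃ m' n' : ℤ, f (v + ((m : ℝ), (n : ℝ))) = f v + ((m' : ℝ), (n' : ℝ)))
    (v : ℝ × ℝ) : descend f (projT2 v) = projT2 (f v) := by
  have h := Function.surjInv_eq isOpenQuotientMap_projT2.surjective (projT2 v)
  obtain ⟨m, n, h1⟩ := projT2_eq_iff.1 h.symm
  obtain ⟨m', n', h2⟩ := hf v m n
  rw [descend, h1, h2, projT2_shift]

lemma descend_planeFlow (t : ℝ) (v : ℝ × ℝ) :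
    descend (planeFlow t) (projT2 v) = projT2 (planeFlow t v) :=
  descend_projT2 (fun v m n => ⟨m, n, planeFlow_shift t v m n⟩) v

lemma descend_planeBack (v : ℝ × ℝ) : descend planeBack (projT2 v) = projT2 (planeBack v) :=
  descend_projT2 (fun v m n => ⟨n, m - n, planeBack_shift v m n⟩) v

lemma descend_planeFwd (v : ℝ × ℝ) : descend planeFwd (projT2 v) = projT2 (planeFwd v) :=
  descend_projT2 (fun v m n => ⟨m + n, m, planeFwd_shift v m n⟩) v

/-- The flow on the torus. -/
def torusFlow : C1FlowT2 where
  flow t := descend (planeFlow t)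
  lift := planeFlow
  lift_contDiff := contDiff_planeFlow
  lift_proj t v := (descend_planeFlow t v).symm
  flow_zero X := by
    obtain ⟨v, rfl⟩ := isOpenQuotientMap_projT2.surjective X
    rw [descend_planeFlow, planeFlow_zero]
  flow_add t s X := by
    obtain ⟨v, rfl⟩ := isOpenQuotientMap_projT2.surjective X
    rw [descend_planeFlow, descend_planeFlow, descend_planeFlow, planeFlow_add]

lemma torusFlow_flow (t : ℝ) (v : ℝ × ℝ) :
    torusFlow.flow t (projT2 v) = projT2 (planeFlow t v) := descend_planeFlow t v

lemma torusFlow_vf (v : ℝ × ℝ) : torusFlow.vf v =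
    (leafSpeed (v.1, height v, height v),
      1 - (1 + gInv) * leafSpeed (v.1, height v, height v)) := deriv_planeFlow v

lemma noCriticalPoints_torusFlow : torusFlow.NoCriticalPoints := by
  intro v h
  rw [torusFlow_vf] at h
  exact (leafSpeed_pos _).ne' (congrArg Prod.fst h)

lemma exists_small_planeFlow_period {T : ℝ} {v : ℝ × ℝ} {m n : ℤ}
    (h : planeFlow T v = v + ((m : ℝ), (n : ℝ))) (k : ℕ) :
    ∃ (w : ℝ × ℝ) (p q : ℤ), planeFlow (gInv ^ k * T) w = w + ((p : ℝ), (q : ℝ)) := by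
  induction k with
  | zero => exact ⟨v, m, n, by simpa using h⟩
  | succ k ih =>
    obtain ⟨w, p, q, hw⟩ := ih
    refine ⟨planeBack w, q, p - q, ?_⟩
    rw [pow_succ', mul_assoc, ← planeBack_planeFlow, hw, planeBack_shift]

lemma tendsto_gInv_pow : Tendsto (fun k : ℕ => gInv ^ k) atTop (𝓝 0) :=
  tendsto_pow_atTop_nhds_zero_of_lt_one gInv_pos.le (by linarith [gInv_lt])

lemma noPeriodicOrbits_torusFlow : torusFlow.NoPeriodicOrbits := by
  intro X T hT hX
  obtain ⟨v, rfl⟩ := isOpenQuotientMap_projT2.surjective X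
  rw [torusFlow_flow] at hX
  obtain ⟨m, n, h⟩ := projT2_eq_iff.1 hX.symm
  have h1 : Tendsto (fun k : ℕ => gInv ^ k * T) atTop (𝓝 (0 * T)) := tendsto_gInv_pow.mul_const T
  rw [zero_mul] at h1
  obtain ⟨k, hk⟩ := (h1.eventually (gt_mem_nhds one_pos)).exists
  have hk0 : 0 < gInv ^ k * T := mul_pos (pow_pos gInv_pos k) hT
  obtain ⟨w, p, q, hw⟩ := exists_small_planeFlow_period h k
  have h2 := abs_leaf_sub_le w.1 (height w) (height w + gInv ^ k * T)
  have h3 := congrArg Prod.fst hw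
  simp only [planeFlow, Prod.fst_add] at h3
  rw [h3, add_sub_cancel_left, add_sub_cancel_left, abs_of_pos hk0] at h2
  have h4 : p = 0 := by
    have : |(p : ℝ)| < 1 := h2.trans_lt hk
    rw [← Int.cast_abs] at this
    exact Int.abs_lt_one_iff.1 (by exact_mod_cast this)
  have h5 := congrArg height hw
  rw [height_planeFlow, height_shift, h4] at h5
  have h6 : gInv ^ k * T = q := by push_cast at h5; linarith
  rw [h6] at hk hk0
  have h7 : 0 < q := by exact_mod_cast hk0
  have h8 : q < 1 := by exact_mod_cast hk
  omega

/-- The vertical circle as a closed transversal. -/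
def verticalCircle : ClosedTransversal torusFlow where
  γ X := (0, X)
  lift s := (0, s)
  lift_contDiff := by fun_prop
  lift_proj s := by simp [projT2]
  inj X Y h := congrArg Prod.snd h
  transverse s := by
    have h : HasDerivAt (fun s : ℝ => ((0 : ℝ), s)) (0, 1) s :=
      (hasDerivAt_const _ _).prodMk (hasDerivAt_id _)
    rw [h.deriv, torusFlow_vf]
    simpa using (leafSpeed_pos _).ne'
  meets X := by
    obtain ⟨v, rfl⟩ := isOpenQuotientMap_projT2.surjective X
    obtain ⟨b, hb⟩ := exists_leaf_eq v.1 (height v) 0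
    refine ⟨b - height v, ((planeFlow (b - height v) v).2 : AddCircle (1 : ℝ)), ?_⟩
    rw [torusFlow_flow]
    simp [projT2, planeFlow, hb]

lemma torusFlow_mem_range_iff (t s : ℝ) :
    torusFlow.flow t (verticalCircle.γ s) ∈ Set.range verticalCircle.γ ↔
      ∃ n : ℤ, leaf (0, s, s + t) = n := by
  rw [← verticalCircle.lift_proj s, torusFlow_flow]
  have h1 : (planeFlow t (verticalCircle.lift s)).1 = leaf (0, s, s + t) := by
    simp [planeFlow, verticalCircle, height]
  have h2 : ∀ w, projT2 w ∈ Set.range verticalCircle.γ ↔ ((0 : ℝ) : AddCircle (1 : ℝ)) = w.1 := by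
    intro w
    constructor
    · rintro ⟨Y, hY⟩
      exact congrArg Prod.fst hY
    · intro h
      exact ⟨(w.2 : AddCircle (1 : ℝ)), Prod.ext h rfl⟩
  rw [h2, h1, coe_addCircle_eq_iff]
  simp

lemma returnTime_verticalCircle (s : ℝ) :
    returnTime torusFlow verticalCircle (verticalCircle.γ s) = hitHeight s - s := by
  refine IsLeast.csInf_eq ⟨⟨?_, ?_⟩, fun t ht => ?_⟩
  · rw [sub_pos, ← (strictMono_leaf_height 0 s).lt_iff_lt, leaf_self, leaf_hitHeight]
    exact one_pos
  · rw [torusFlow_mem_range_iff]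
    exact ⟨1, by simp [leaf_hitHeight]⟩
  · obtain ⟨h0, h1⟩ := ht
    rw [torusFlow_mem_range_iff] at h1
    obtain ⟨n, hn⟩ := h1
    have h2 : leaf (0, s, s) < leaf (0, s, s + t) := strictMono_leaf_height 0 s (by linarith)
    rw [leaf_self, hn] at h2
    have h3 : (1 : ℝ) ≤ n := by
      have : 0 < n := by exact_mod_cast h2
      exact_mod_cast this
    rw [← hn, ← leaf_hitHeight s] at h3
    have := (strictMono_leaf_height 0 s).le_iff_le.1 h3
    linarith

lemma returnMapLift_returnLift : ReturnMapLift torusFlow verticalCircle returnLift := by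
  intro s
  rw [returnTime_verticalCircle, ← verticalCircle.lift_proj s, torusFlow_flow,
    ← verticalCircle.lift_proj, projT2_eq_iff]
  refine ⟨1, 0, ?_⟩
  simp [verticalCircle, planeFlow, height, leaf_hitHeight, returnLift_apply]

/-! ### The invariant set and the renormalization -/

lemma planeBack_iterate_planeFlow (k : ℕ) (t : ℝ) (v : ℝ × ℝ) :
    planeBack^[k] (planeFlow t v) = planeFlow (gInv ^ k * t) (planeBack^[k] v) := by
  induction k generalizing t v with
  | zero => simp
  | succ k ih =>
    rw [Function.iterate_succ_apply, Function.iterate_succ_apply, planeBack_planeFlow, ih,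
      pow_succ, mul_assoc]

lemma planeBack_iterate_shift (k : ℕ) (v : ℝ × ℝ) (m n : ℤ) :
    ∃ p q : ℤ, planeBack^[k] (v + ((m : ℝ), (n : ℝ))) =
      planeBack^[k] v + ((p : ℝ), (q : ℝ)) := by
  induction k generalizing v m n with
  | zero => exact ⟨m, n, rfl⟩
  | succ k ih =>
    simp only [Function.iterate_succ_apply]
    rw [planeBack_shift]
    exact ih _ _ _

/-- A point of period two of `planeBack`. -/
def basePoint : ℝ × ℝ := (1 / 4, -((1 + gInv) * (1 / 4)))

lemma planeBack_iterate_basePoint (k : ℕ) :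
    |(planeBack^[k] basePoint).1| = 1 / 4 := by
  have hs : gSymm (1 / 4) = 1 / 4 := by
    conv_lhs => rw [← gMap_quarter, gSymm_gMap]
  have hs' : gSymm (-(1 / 4)) = -(1 / 4) := by
    conv_lhs => rw [← gMap_quarter, ← gMap_neg, gSymm_gMap]
  have h : ∀ v, height v = 0 → |v.1| = 1 / 4 →
      height (planeBack v) = 0 ∧ |(planeBack v).1| = 1 / 4 := by
    intro v h1 h2
    refine ⟨by rw [height_planeBack, h1, mul_zero], ?_⟩
    rw [planeBack_fst, h1, mul_zero, zero_sub]
    rcases (abs_eq (by norm_num)).1 h2 with h3 | h3 <;> rw [h3]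
    · rw [hs', abs_neg, abs_of_pos (by norm_num)]
    · rw [neg_neg, hs, abs_of_pos (by norm_num)]
  have h' : height (planeBack^[k] basePoint) = 0 ∧ |(planeBack^[k] basePoint).1| = 1 / 4 := by
    induction k with
    | zero => exact ⟨by simp [height, basePoint], by norm_num [basePoint]⟩
    | succ k ih =>
      rw [Function.iterate_succ_apply']
      exact h _ ih.1 ih.2
  exact h'.2

lemma exists_planeBack_attracts : ∃ U ∈ 𝓝 (0 : ℝ × ℝ), ∀ v ∈ U,
    Tendsto (fun k => (planeBack^[k] v).1) atTop (𝓝 0) := by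
  obtain ⟨δ, hδ, κ, hκ0, hκ1, hκ⟩ := exists_gSymm_contracts
  have hg0 := gInv_pos
  have hg1 := gInv_lt
  set N : ℝ × ℝ → ℝ := fun v => |v.1| + 3 * |height v| with hN
  set θ := max κ (9 / 10) with hθ
  have hθ1 : θ < 1 := max_lt hκ1 (by norm_num)
  have hθ0 : 0 ≤ θ := le_max_of_le_left hκ0
  have step : ∀ v, N v ≤ δ → N (planeBack v) ≤ θ * N v := by
    intro v hv
    simp only [hN] at hv ⊢
    have h1 : |gInv * height v - v.1| ≤ gInv * |height v| + |v.1| := by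
      refine (abs_sub _ _).trans_eq ?_
      rw [abs_mul, abs_of_pos hg0]
    have ha := abs_nonneg (height v)
    have hb := abs_nonneg v.1
    have h2 := hκ (gInv * height v - v.1) (by nlinarith)
    rw [planeBack_fst, height_planeBack, abs_mul, abs_of_pos hg0]
    have h3 : κ * |gInv * height v - v.1| ≤ κ * (gInv * |height v| + |v.1|) := by gcongr
    have h4 : κ * |v.1| ≤ θ * |v.1| := by gcongr; exact le_max_left _ _
    have h5 : 9 / 10 * |height v| ≤ θ * |height v| := by gcongr; exact le_max_right _ _
    have h6 : κ * (gInv * |height v|) ≤ 1 * (6181 / 10000 * |height v|) := by gcongr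
    nlinarith
  have iter : ∀ v, N v ≤ δ → ∀ k : ℕ, N (planeBack^[k] v) ≤ θ ^ k * N v := by
    intro v hv k
    have hv0 : 0 ≤ N v := by simp only [hN]; positivity
    induction k with
    | zero => simp
    | succ k ih =>
      rw [Function.iterate_succ_apply', pow_succ', mul_assoc]
      refine (step _ (ih.trans ?_)).trans (by gcongr)
      exact (mul_le_of_le_one_left hv0 (pow_le_one₀ hθ0 hθ1.le)).trans hv
  have hNc : Continuous N := by simp only [hN, height]; fun_prop
  refine ⟨{v | N v < δ}, hNc.continuousAt.eventually (gt_mem_nhds ?_), fun v hv => ?_⟩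
  · simpa [hN, height] using hδ
  · have h1 : Tendsto (fun k : ℕ => θ ^ k * N v) atTop (𝓝 (0 * N v)) :=
      (tendsto_pow_atTop_nhds_zero_of_lt_one hθ0 hθ1).mul_const _
    rw [zero_mul] at h1
    refine squeeze_zero_norm (fun k => ?_) h1
    refine le_trans ?_ (iter v (le_of_lt hv) k)
    simp only [hN, Real.norm_eq_abs]
    linarith [abs_nonneg (height (planeBack^[k] v))]

lemma continuous_torusFlow (t : ℝ) : Continuous (torusFlow.flow t) := by
  rw [← isOpenQuotientMap_projT2.continuous_comp_iff]
  have h : torusFlow.flow t ∘ projT2 = projT2 ∘ planeFlow t := funext (torusFlow_flow t)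
  rw [h]
  refine isOpenQuotientMap_projT2.continuous.comp ?_
  exact contDiff_planeFlow.continuous.comp (by fun_prop : Continuous fun v : ℝ × ℝ => (t, v))

lemma zero_notMem_closure_orbit :
    projT2 0 ∉ closure (Set.range fun t => torusFlow.flow t (projT2 basePoint)) := by
  intro h0
  obtain ⟨U, hU, hUa⟩ := exists_planeBack_attracts
  obtain ⟨_, ⟨v, hv, hvX⟩, t, ht⟩ := mem_closure_iff_nhds.1 h0 _
    (isOpenQuotientMap_projT2.isOpenMap.image_mem_nhds hU)
  simp only [torusFlow_flow] at ht
  rw [← hvX, projT2_eq_iff] at ht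
  obtain ⟨m, n, hmn⟩ := ht
  set w := basePoint + ((m : ℝ), (n : ℝ)) with hw
  have hvw : v = planeFlow t w := by rw [hmn, hw, planeFlow_shift]
  have h1 : Tendsto (fun k => (planeBack^[k] w).1) atTop (𝓝 0) := by
    have h2 := hUa v hv
    have h3 : Tendsto (fun k => (planeBack^[k] w).1 - (planeBack^[k] v).1) atTop (𝓝 0) := by
      have h4 : Tendsto (fun k : ℕ => gInv ^ k * |t|) atTop (𝓝 (0 * |t|)) :=
        tendsto_gInv_pow.mul_const _
      rw [zero_mul] at h4
      refine squeeze_zero_norm (fun k => ?_) h4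
      rw [hvw, planeBack_iterate_planeFlow, Real.norm_eq_abs, abs_sub_comm]
      refine (abs_leaf_sub_le _ _ _).trans_eq ?_
      rw [add_sub_cancel_left, abs_mul, abs_of_pos (pow_pos gInv_pos k)]
    simpa using h3.add h2
  obtain ⟨k, hk⟩ := (h1.abs.eventually (gt_mem_nhds (show |(0 : ℝ)| < 1 / 4 by simp))).exists
  obtain ⟨p, q, hpq⟩ := planeBack_iterate_shift k basePoint m n
  have h5 := planeBack_iterate_basePoint k
  rw [hw, hpq, Prod.fst_add] at hk
  simp only at hk
  have h6 := abs_sub_abs_le_abs_sub ((planeBack^[k] basePoint).1 + p)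
    (planeBack^[k] basePoint).1
  rw [add_sub_cancel_left] at h6
  have h7 := abs_sub ((planeBack^[k] basePoint).1 + p) (planeBack^[k] basePoint).1
  rw [add_sub_cancel_left] at h7
  have h8 : p = 0 := by
    have : |(p : ℝ)| < 1 := by linarith
    rw [← Int.cast_abs] at this
    exact Int.abs_lt_one_iff.1 (by exact_mod_cast this)
  rw [h8, Int.cast_zero, add_zero, h5] at hk
  exact lt_irrefl _ hk

lemma continuous_descend {f : ℝ × ℝ → ℝ × ℝ} (hf : Continuous f)
    (h : ∀ v, descend f (projT2 v) = projT2 (f v)) : Continuous (descend f) := by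
  rw [← isOpenQuotientMap_projT2.continuous_comp_iff, show descend f ∘ projT2 = projT2 ∘ f from
    funext h]
  exact isOpenQuotientMap_projT2.continuous.comp hf

/-- The renormalization as a homeomorphism of the torus. -/
def torusBack : T2 ≃ₜ T2 where
  toFun := descend planeBack
  invFun := descend planeFwd
  left_inv X := by
    obtain ⟨v, rfl⟩ := isOpenQuotientMap_projT2.surjective X
    rw [descend_planeBack, descend_planeFwd, planeFwd_planeBack]
  right_inv X := by
    obtain ⟨v, rfl⟩ := isOpenQuotientMap_projT2.surjective X
    rw [descend_planeFwd, descend_planeBack, planeBack_planeFwd]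
  continuous_toFun := continuous_descend contDiff_planeBack.continuous descend_planeBack
  continuous_invFun := continuous_descend contDiff_planeFwd.continuous descend_planeFwd

lemma torusBack_projT2 (v : ℝ × ℝ) : torusBack (projT2 v) = projT2 (planeBack v) :=
  descend_planeBack v

lemma torusBack_symm_projT2 (v : ℝ × ℝ) : torusBack.symm (projT2 v) = projT2 (planeFwd v) :=
  descend_planeFwd v

lemma torusBack_flow (t : ℝ) (X : T2) :
    torusBack (torusFlow.flow t X) = torusFlow.flow (gInv * t) (torusBack X) := by
  obtain ⟨v, rfl⟩ := isOpenQuotientMap_projT2.surjective X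
  rw [torusFlow_flow, torusBack_projT2, torusBack_projT2, torusFlow_flow, planeBack_planeFlow]

lemma exists_proper_invariant_set :
    ∃ K : Set T2, K.Nonempty ∧ IsClosed K ∧ K ≠ Set.univ ∧
      ∀ (t : ℝ) (x : T2), x ∈ K → torusFlow.flow t x ∈ K := by
  refine ⟨closure (Set.range fun t => torusFlow.flow t (projT2 basePoint)),
    (Set.range_nonempty _).closure, isClosed_closure, fun h => ?_, fun t X hX => ?_⟩
  · exact zero_notMem_closure_orbit (h ▸ Set.mem_univ _)
  · refine map_mem_closure (continuous_torusFlow t) hX ?_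
    rintro _ ⟨s, rfl⟩
    exact ⟨t + s, torusFlow.flow_add t s _⟩

end Construction

/-- **Existence of a nonminimal example.** There is a `C¹` flow on `𝕋²` without
critical points and periodic orbits, admitting a closed transversal whose first return
map has rotation number of constant type, which is not minimal (it has a nonempty
proper closed invariant subset), and which is renormalized by a `C¹` diffeomorphism
`F` of `𝕋²`: `F ∘ h_t = h_{ct} ∘ F` for some `0 < c < 1`. -/
theorem exists_nonminimal_flow :
    ∃ h : C1FlowT2, h.NoCriticalPoints ∧ h.NoPeriodicOrbits ∧
      (∃ (Γ : ClosedTransversal h) (F : CircleDeg1Liftˣ),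
        ReturnMapLift h Γ (F : CircleDeg1Lift) ∧
        IsOfConstantType ((F : CircleDeg1Lift).translationNumber)) ∧
      (∃ K : Set T2, K.Nonempty ∧ IsClosed K ∧ K ≠ Set.univ ∧
        ∀ (t : ℝ) (x : T2), x ∈ K → h.flow t x ∈ K) ∧
      (∃ (f : T2 ≃ₜ T2) (FL : ℝ × ℝ → ℝ × ℝ) (Glift : ℝ × ℝ → ℝ × ℝ) (c : ℝ),
        ContDiff ℝ 1 FL ∧ ContDiff ℝ 1 Glift ∧
        (∀ v, projT2 (FL v) = f (projT2 v)) ∧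
        (∀ v, projT2 (Glift v) = f.symm (projT2 v)) ∧
        0 < c ∧ c < 1 ∧
        ∀ (t : ℝ) (x : T2), f (h.flow t x) = h.flow (c * t) (f x)) := by
  refine ⟨torusFlow, noCriticalPoints_torusFlow, noPeriodicOrbits_torusFlow,
    ⟨verticalCircle, isUnit_returnLift.unit, ?_, ?_⟩, exists_proper_invariant_set,
    torusBack, planeBack, planeFwd, gInv, contDiff_planeBack, contDiff_planeFwd,
    fun v => (torusBack_projT2 v).symm, fun v => (torusBack_symm_projT2 v).symm, gInv_pos,
    by linarith [gInv_lt], torusBack_flow⟩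
  · rw [IsUnit.unit_spec]; exact returnMapLift_returnLift
  · rw [IsUnit.unit_spec, translationNumber_returnLift]
    exact ⟨gInv_irrational, 1, isOfConstantType_gInv_aux⟩
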